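/- Let u be a smooth spatially decaying solution of uₜ + uuₓ = ∂ₓ(I-∂ₓ²)^{-1}(ρ̄ - u) on [0,T) with ρ̄ ≥ 0, ‖ρ̄(t,·)‖_{L¹} = ‖ρ̄₀‖_{L¹} for all t. Then d/dt ‖u(t)‖_{L²} ≤ ‖ρ̄₀‖_{L¹}, and hence ‖u(t)‖_{L²} ≤ ‖u₀‖_{L²} + ‖ρ̄₀‖_{L¹} t for all t ∈ [0,T). -/

import Mathlib

open MeasureTheory Real

/-- The operator `∂ₓ(I-∂ₓ²)⁻¹`, realized as convolution with `-½ sign(x) e^{-|x|}`. -/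
noncomputable def dConvOp (f : ℝ → ℝ) (x : ℝ) : ℝ :=
  ∫ y : ℝ, (-(1 : ℝ)/2) * Real.sign (x - y) * Real.exp (-|x - y|) * f y


/-- Abstract ODE comparison. -/
lemma aux_ode_le (E : ℝ → ℝ) (M S a b : ℝ) (hM : 0 ≤ M) (hab : a ≤ b) (hSpos : 0 < S)
    (hE0 : ∀ t, 0 ≤ E t) (hS : ∀ t ∈ Set.Icc a b, E t ≤ S)
    (H : ∀ s t, a ≤ s → s ≤ t → t ≤ b → ∀ C, 0 < C → (∀ τ ∈ Set.Icc s t, E τ ≤ C) →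
      |E t ^ 2 - E s ^ 2| ≤ 2 * M * C * (t - s)) :
    E b ≤ E a + M * (b - a) := by
  have hlip : ∀ s ∈ Set.Icc a b, ∀ t ∈ Set.Icc a b,
      |E t ^ 2 - E s ^ 2| ≤ 2 * M * S * |t - s| := by
    intro s hs t ht
    rcases le_total s t with h | h
    · rw [abs_of_nonneg (sub_nonneg.2 h)]
      exact H s t hs.1 h ht.2 S hSpos (fun τ hτ => hS τ ⟨hs.1.trans hτ.1, hτ.2.trans ht.2⟩)
    · rw [abs_sub_comm, abs_sub_comm t s, abs_of_nonneg (sub_nonneg.2 h)]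
      exact H t s ht.1 h hs.2 S hSpos (fun τ hτ => hS τ ⟨ht.1.trans hτ.1, hτ.2.trans hs.2⟩)
  have hcont2 : ContinuousOn (fun t => E t ^ 2) (Set.Icc a b) := by
    have : LipschitzOnWith (Real.toNNReal (2 * M * S)) (fun t => E t ^ 2) (Set.Icc a b) := by
      apply LipschitzOnWith.of_dist_le_mul
      intro x hx y hy
      rw [Real.dist_eq, Real.dist_eq, Real.coe_toNNReal _ (by positivity)]
      exact hlip y hy x hx
    exact this.continuousOn
  have hcont : ContinuousOn E (Set.Icc a b) := by
    have := hcont2.sqrt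
    refine this.congr (fun t _ => ?_)
    simp [Real.sqrt_sq (hE0 t)]
  have key : ∀ ε > 0, E b ≤ E a + ε + (M + ε) * (b - a) := by
    intro ε hε
    have hmain : ∀ x ∈ Set.Icc a b, E x ^ 2 ≤ (E a + ε + (M + ε) * (x - a)) ^ 2 := by
      refine image_le_of_liminf_slope_right_lt_deriv_boundary (f := fun t => E t ^ 2)
        (f' := fun t => 2 * M * E t)
        (B := fun x => (E a + ε + (M + ε) * (x - a)) ^ 2)
        (B' := fun x => 2 * (E a + ε + (M + ε) * (x - a)) * (M + ε)) hcont2 ?_ ?_ ?_ ?_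
      · intro x hx r hr
        obtain ⟨C, hC1, hC2⟩ : ∃ C, E x < C ∧ 2 * M * C < r := by
          have : Filter.Tendsto (fun C => 2 * M * C) (nhdsWithin (E x) (Set.Ioi (E x)))
              (nhds (2 * M * E x)) :=
            ((continuous_const.mul continuous_id).tendsto _).mono_left nhdsWithin_le_nhds
          have h2 := this.eventually_lt_const hr
          obtain ⟨C, h3, h4⟩ := (h2.and self_mem_nhdsWithin).exists
          exact ⟨C, h4, h3⟩
        have hxc : ContinuousWithinAt E (Set.Icc a b) x := hcont x ⟨hx.1, hx.2.le⟩
        have hev := hxc.eventually_lt_const hC1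
        have hev2 : ∀ᶠ y in nhdsWithin x (Set.Ici x), E y < C := by
          have h1 : nhdsWithin x (Set.Ici x) ≤ nhdsWithin x (Set.Icc a b) := by
            rw [← nhdsWithin_Icc_eq_nhdsGE hx.2]
            exact nhdsWithin_mono _ (Set.Icc_subset_Icc_left hx.1)
          exact h1 hev
        obtain ⟨c, hc, hcs⟩ := (mem_nhdsGE_iff_exists_Icc_subset).1 hev2
        have hxc' : x < c := hc
        have : ∀ᶠ z in nhdsWithin x (Set.Ioi x), z ∈ Set.Ioo x (min c b) :=
          Ioo_mem_nhdsGT (lt_min hxc' hx.2)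
        refine this.frequently.mono ?_
        intro z hz
        have hz1 := hz.1
        have hz2 := lt_min_iff.1 hz.2
        have := H x z hx.1 hz.1.le hz2.2.le C ((hE0 x).trans_lt hC1) (fun τ hτ => (hcs ⟨hτ.1, hτ.2.trans hz2.1.le⟩).le)
        rw [slope_def_field, div_lt_iff₀ (sub_pos.2 hz.1)]
        calc E z ^ 2 - E x ^ 2 ≤ _ := le_abs_self _
          _ ≤ _ := this
          _ < _ := mul_lt_mul_of_pos_right hC2 (sub_pos.2 hz.1)
      · have := hE0 a
        simp only [sub_self, mul_zero, add_zero]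
        gcongr; linarith
      · intro x
        have h1 : HasDerivAt (fun x => E a + ε + (M + ε) * (x - a)) (M + ε) x := by
          simpa using (((hasDerivAt_id x).sub_const a).const_mul (M + ε)).const_add (E a + ε)
        have := h1.fun_pow 2
        simpa using this
      · intro x hx hxe
        have h0 : 0 < E a + ε + (M + ε) * (x - a) := by
          have := hE0 a
          have := mul_nonneg (by linarith : 0 ≤ M + ε) (sub_nonneg.2 hx.1)
          linarith
        have : E x = E a + ε + (M + ε) * (x - a) :=
          (pow_left_inj₀ (hE0 x) h0.le two_ne_zero).1 hxe
        simp only [this]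
        nlinarith [mul_pos h0 hε]
    refine (sq_le_sq₀ (hE0 b) ?_).1 (hmain b ⟨hab, le_rfl⟩)
    have := hE0 a
    have := mul_nonneg (by linarith : 0 ≤ M + ε) (sub_nonneg.2 hab)
    linarith
  refine le_of_tendsto_of_tendsto (b := nhdsWithin (0:ℝ) (Set.Ioi 0)) tendsto_const_nhds
    (g := fun ε => E a + ε + (M + ε) * (b - a)) ?_ ?_
  · have : Filter.Tendsto (fun ε : ℝ => E a + ε + (M + ε) * (b - a)) (nhds 0)
      (nhds (E a + 0 + (M + 0) * (b - a))) := Continuous.tendsto (by fun_prop) 0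
    simp only [add_zero] at this
    exact this.mono_left nhdsWithin_le_nhds
  · filter_upwards [self_mem_nhdsWithin] with ε hε using key ε hε

lemma aux_ode (E : ℝ → ℝ) (M S a b : ℝ) (hM : 0 ≤ M) (hab : a ≤ b) (hSpos : 0 < S)
    (hE0 : ∀ t, 0 ≤ E t) (hS : ∀ t ∈ Set.Icc a b, E t ≤ S)
    (H : ∀ s t, a ≤ s → s ≤ t → t ≤ b → ∀ C, 0 < C → (∀ τ ∈ Set.Icc s t, E τ ≤ C) →
      |E t ^ 2 - E s ^ 2| ≤ 2 * M * C * (t - s)) :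
    |E b - E a| ≤ M * (b - a) := by
  have h1 := aux_ode_le E M S a b hM hab hSpos hE0 hS H
  have h2 := aux_ode_le (fun t => E (a + b - t)) M S a b hM hab hSpos (fun t => hE0 _)
    (fun t ht => hS _ ⟨by linarith [ht.2], by linarith [ht.1]⟩) (by
      intro s t hs hst ht C hC0 hC
      have := H (a + b - t) (a + b - s) (by linarith) (by linarith) (by linarith) C hC0 (by
        intro τ hτ
        have := hC (a + b - τ) ⟨by linarith [hτ.2], by linarith [hτ.1]⟩
        simpa using this)
      rw [abs_sub_comm]
      convert this using 1
      ring)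
  simp only [add_sub_cancel_right, add_sub_cancel_left] at h2
  rw [abs_le]; constructor <;> linarith

/-- Baire category argument. -/
lemma aux_baire (E : ℝ → ℝ) (M L : ℝ) (hM : 0 ≤ M)
    (hcl : ∀ n : ℕ, IsClosed {t | t ∈ Set.Icc 0 L ∧ E t ≤ n})
    (P : ∀ a b, 0 ≤ a → a ≤ b → b ≤ L → (∃ S, ∀ t ∈ Set.Icc a b, E t ≤ S) →
      |E b - E a| ≤ M * (b - a)) :
    ∃ S, ∀ t ∈ Set.Icc 0 L, E t ≤ S := by
  -- good points
  set G : Set ℝ := {t | ∃ U ∈ nhds t, ∃ S, ∀ s ∈ U ∩ Set.Icc 0 L, E s ≤ S} with hG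
  have hGo : IsOpen G := by
    rw [isOpen_iff_mem_nhds]
    rintro t ⟨U, hU, S, hS⟩
    filter_upwards [eventually_mem_nhds_iff.2 hU] with s hs
    exact ⟨U, hs, S, hS⟩
  have hcpt : ∀ a b, 0 ≤ a → b ≤ L → Set.Icc a b ⊆ G → ∃ S, ∀ t ∈ Set.Icc a b, E t ≤ S := by
    intro a b ha hb hsub
    refine isCompact_Icc.induction_on (p := fun s => ∃ S, ∀ t ∈ s ∩ Set.Icc a b, E t ≤ S) ?_ ?_ ?_ ?_
      |>.imp (fun S hS t ht => hS t ⟨ht, ht⟩)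
    · exact ⟨0, by simp⟩
    · rintro s t hst ⟨S, hS⟩
      exact ⟨S, fun x hx => hS x ⟨hst hx.1, hx.2⟩⟩
    · rintro s t ⟨S, hS⟩ ⟨S', hS'⟩
      refine ⟨max S S', ?_⟩
      rintro x ⟨hx | hx, hx2⟩
      · exact (hS x ⟨hx, hx2⟩).trans (le_max_left _ _)
      · exact (hS' x ⟨hx, hx2⟩).trans (le_max_right _ _)
    · intro x hx
      obtain ⟨U, hU, S, hS⟩ := hsub hx
      exact ⟨U, mem_nhdsWithin_of_mem_nhds hU, S, fun y hy =>
        hS y ⟨hy.1, ha.trans hy.2.1, hy.2.2.trans hb⟩⟩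
  by_cases hB : (Set.Icc 0 L ⊆ G)
  · exact hcpt 0 L le_rfl le_rfl hB
  exfalso
  set B : Set ℝ := Set.Icc 0 L \ G with hBdef
  have hBne : B.Nonempty := Set.sdiff_nonempty.2 hB
  have hBc : IsClosed B := isClosed_Icc.sdiff hGo
  have : CompleteSpace B := hBc.completeSpace_coe
  have : Nonempty B := hBne.to_subtype
  obtain ⟨n, ⟨z, hzB⟩, hz⟩ := nonempty_interior_of_iUnion_of_closed
    (f := fun n : ℕ => {t : B | E t ≤ n}) (by
      intro n
      have : {t : B | E t ≤ n} = (Subtype.val) ⁻¹' {t | t ∈ Set.Icc 0 L ∧ E t ≤ n} := by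
        ext t
        have := t.2.1
        simp only [Set.mem_ofPred_eq, Set.mem_preimage]
        tauto
      rw [this]
      exact (hcl n).preimage continuous_subtype_val) (by
      ext t
      simpa using exists_nat_ge (E t))
  rw [mem_interior_iff_mem_nhds, nhds_subtype_eq_comap, Filter.mem_comap] at hz
  obtain ⟨V, hV, hVs⟩ := hz
  obtain ⟨δ, hδ, hball⟩ := Metric.mem_nhds_iff.1 hV
  have hEB : ∀ t ∈ B, |t - z| < δ → E t ≤ n := by
    intro t ht htz
    exact hVs (a := ⟨t, ht⟩) (hball (by simpa [Real.dist_eq] using htz))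
  apply hzB.2
  refine ⟨Metric.ball z δ, Metric.ball_mem_nhds _ hδ, n + M * δ, ?_⟩
  rintro t ⟨htb, ht⟩
  rw [Metric.mem_ball, Real.dist_eq] at htb
  have hn : E z ≤ n := hEB z hzB (by simpa using hδ)
  by_cases htB : t ∈ B
  · have := hEB t htB htb
    nlinarith
  have htz : t ≠ z := fun h => htB (h ▸ hzB)
  rcases lt_or_gt_of_ne htz with hlt | hlt
  · -- t < z
    have hne : (B ∩ Set.Icc t z).Nonempty := ⟨z, hzB, hlt.le, le_rfl⟩
    have hcp : IsCompact (B ∩ Set.Icc t z) := isCompact_Icc.inter_left hBc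
    obtain ⟨w, ⟨hwB, hw⟩, hwm⟩ := hcp.exists_isLeast hne
    have htw : t < w := lt_of_le_of_ne hw.1 (fun h => htB (h ▸ hwB))
    have hgood : ∀ s, t ≤ s → s < w → s ∈ G := by
      intro s h1 h2
      by_contra hc
      have := hwm ⟨⟨⟨ht.1.trans h1, h2.le.trans hwB.1.2⟩, hc⟩, h1, h2.le.trans hw.2⟩
      linarith
    have hbd : ∃ S, ∀ s ∈ Set.Icc t w, E s ≤ S := by
      refine ⟨max (E w) (E t + M * (w - t)), ?_⟩
      intro s hs
      rcases hs.2.eq_or_lt with h | h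
      · rw [h]; exact le_max_left _ _
      · have h3 := P t s ht.1 hs.1 (hs.2.trans hwB.1.2) (hcpt t s ht.1 (hs.2.trans hwB.1.2)
          (fun r hr => hgood r hr.1 (hr.2.trans_lt h)))
        refine le_trans ?_ (le_max_right _ _)
        have := (abs_le.1 h3).2
        nlinarith [hs.2]
    have h4 := (abs_le.1 (P t w ht.1 htw.le hwB.1.2 hbd)).1
    have h5 := abs_lt.1 htb
    have h6 : E w ≤ n := hEB w hwB (by rw [abs_lt]; constructor <;> linarith [hw.2])
    have : M * (w - t) ≤ M * δ := mul_le_mul_of_nonneg_left (by linarith [hw.2]) hM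
    linarith
  · -- z < t
    have hne : (B ∩ Set.Icc z t).Nonempty := ⟨z, hzB, le_rfl, hlt.le⟩
    have hcp : IsCompact (B ∩ Set.Icc z t) := isCompact_Icc.inter_left hBc
    obtain ⟨w, ⟨hwB, hw⟩, hwm⟩ := hcp.exists_isGreatest hne
    have htw : w < t := lt_of_le_of_ne hw.2 (fun h => htB (h ▸ hwB))
    have hgood : ∀ s, w < s → s ≤ t → s ∈ G := by
      intro s h1 h2
      by_contra hc
      have := hwm ⟨⟨⟨hwB.1.1.trans h1.le, h2.trans ht.2⟩, hc⟩, hw.1.trans h1.le, h2⟩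
      linarith
    have hbd : ∃ S, ∀ s ∈ Set.Icc w t, E s ≤ S := by
      refine ⟨max (E w) (E t + M * (t - w)), ?_⟩
      intro s hs
      rcases hs.1.eq_or_lt with h | h
      · rw [← h]; exact le_max_left _ _
      · have h3 := P s t (hwB.1.1.trans hs.1) hs.2 ht.2 (hcpt s t (hwB.1.1.trans hs.1) ht.2
          (fun r hr => hgood r (h.trans_le hr.1) hr.2))
        refine le_trans ?_ (le_max_right _ _)
        have := (abs_le.1 h3).1
        nlinarith [hs.1]
    have h4 := (abs_le.1 (P w t hwB.1.1 htw.le ht.2 hbd)).2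
    have h5 := abs_lt.1 htb
    have h6 : E w ≤ n := hEB w hwB (by rw [abs_lt]; constructor <;> linarith [hw.1])
    have : M * (t - w) ≤ M * δ := mul_le_mul_of_nonneg_left (by linarith [hw.1]) hM
    linarith

noncomputable def auxK (z : ℝ) : ℝ := (-(1 : ℝ)/2) * Real.sign z * Real.exp (-|z|)

lemma auxK_meas : Measurable auxK := by
  have h : Measurable Real.sign := by
    unfold Real.sign
    exact Measurable.ite measurableSet_Iio measurable_const
      (Measurable.ite measurableSet_Ioi measurable_const measurable_const)
  unfold auxK
  exact (measurable_const.mul h).mul (by fun_prop)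

lemma auxK_le (z : ℝ) : |auxK z| ≤ (1/2) * Real.exp (-|z|) := by
  unfold auxK
  have hs : |Real.sign z| ≤ 1 := by
    rcases Real.sign_apply_eq z with h | h | h <;> simp [h]
  rw [abs_mul, abs_mul, abs_of_pos (Real.exp_pos _)]
  have : |(-(1:ℝ)/2)| = 1/2 := by norm_num [abs_div]
  rw [this]
  have := Real.exp_pos (-|z|)
  gcongr
  linarith

lemma auxK_le' (z : ℝ) : |auxK z| ≤ 1 := by
  have := auxK_le z
  have h2 : Real.exp (-|z|) ≤ 1 := Real.exp_le_one_iff.2 (by simp)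
  linarith

lemma auxK_odd (z : ℝ) : auxK (-z) = - auxK z := by
  unfold auxK
  rw [abs_neg]
  have : Real.sign (-z) = - Real.sign z := by
    rcases lt_trichotomy z 0 with h | h | h
    · rw [Real.sign_of_neg h, Real.sign_of_pos (by linarith)]; simp
    · simp [h]
    · rw [Real.sign_of_pos h, Real.sign_of_neg (by linarith)]
  rw [this]; ring

lemma aux_int_exp (c : ℝ) (hc : 0 < c) : Integrable (fun x : ℝ => Real.exp (-(c * |x|))) := by
  have h : IntegrableOn (fun x : ℝ => Real.exp (-(c * |x|))) (Set.Ioi 0) := by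
    refine (integrableOn_exp_mul_Ioi (a := -c) (by linarith) 0).congr_fun ?_ measurableSet_Ioi
    intro x hx
    have : |x| = x := abs_of_pos hx
    simp [this]
  have h' : IntegrableOn (fun x : ℝ => Real.exp (-(c * |x|))) (Set.Iic 0) := by
    refine (integrableOn_exp_mul_Iic (a := c) hc 0).congr_fun ?_ measurableSet_Iic
    intro x hx
    have : |x| = -x := abs_of_nonpos hx
    simp [this]
  rw [← integrableOn_univ, ← Set.Iic_union_Ioi (a := (0:ℝ))]
  exact h'.union h

lemma aux_exp_sq : ∫ x : ℝ, (Real.exp (-|x|)) ^ 2 = 1 := by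
  have h := integral_comp_abs (f := fun x : ℝ => (Real.exp (-x)) ^ 2)
  rw [h]
  have : ∀ x : ℝ, (Real.exp (-x)) ^ 2 = Real.exp ((-2) * x) := by
    intro x; rw [← Real.exp_nat_mul]; congr 1; push_cast; ring
  simp only [this]
  rw [integral_exp_mul_Ioi (by norm_num)]
  norm_num

lemma aux_int_exp_sq : Integrable (fun x : ℝ => (Real.exp (-|x|)) ^ 2) := by
  have := aux_int_exp 2 (by norm_num)
  refine this.congr (Filter.Eventually.of_forall fun x => ?_)
  simp only []
  rw [← Real.exp_nat_mul]; congr 1; push_cast; ring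

lemma auxK_int : Integrable auxK := by
  have := aux_int_exp 1 (by norm_num)
  simp only [one_mul] at this
  refine (this.const_mul (1/2)).mono' auxK_meas.aestronglyMeasurable ?_
  exact Filter.Eventually.of_forall fun x => by simpa using auxK_le x

lemma aux_cs (v : ℝ → ℝ) (hv2 : Integrable (fun x => v x ^ 2)) (s : ℝ) (hs : 0 < s)
    (hY : ∫ x, v x ^ 2 ≤ s ^ 2) (y : ℝ) : ∫ x, |auxK (x - y)| * |v x| ≤ s := by
  have hk : Integrable (fun x : ℝ => (Real.exp (-|x - y|)) ^ 2) := aux_int_exp_sq.comp_sub_right y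
  have hk1 : ∫ x : ℝ, (Real.exp (-|x - y|)) ^ 2 = 1 := by
    rw [integral_sub_right_eq_self (fun x : ℝ => (Real.exp (-|x|)) ^ 2) y, aux_exp_sq]
  have hb : Integrable (fun x => s * (Real.exp (-|x - y|)) ^ 2 + s⁻¹ * v x ^ 2) :=
    (hk.const_mul s).add (hv2.const_mul s⁻¹)
  have h1 : ∫ x, |auxK (x - y)| * |v x| ≤
      ∫ x, (1/4) * (s * (Real.exp (-|x - y|)) ^ 2 + s⁻¹ * v x ^ 2) := by
    refine integral_mono_of_nonneg (Filter.Eventually.of_forall fun x => by positivity)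
      (hb.const_mul _) (Filter.Eventually.of_forall fun x => ?_)
    simp only []
    have h2 := auxK_le (x - y)
    set k := Real.exp (-|x - y|)
    have h3 : |auxK (x - y)| * |v x| ≤ (1/2) * k * |v x| := by gcongr
    have h4 : 0 ≤ s⁻¹ * (s * k - |v x|) ^ 2 := by positivity
    have h5 : s⁻¹ * (s * k - |v x|) ^ 2 = s * k ^ 2 + s⁻¹ * v x ^ 2 - 2 * k * |v x| := by
      rw [← sq_abs (v x)]; field_simp; ring
    linarith
  refine h1.trans ?_
  rw [integral_const_mul, integral_add (hk.const_mul s) (hv2.const_mul s⁻¹), integral_const_mul,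
    integral_const_mul, hk1]
  have : s⁻¹ * ∫ x, v x ^ 2 ≤ s := by
    rw [inv_mul_le_iff₀ hs]; nlinarith
  linarith

lemma aux_W (v f : ℝ → ℝ) (hv : Integrable v) (hf : Integrable f) :
    Integrable (fun p : ℝ × ℝ => auxK (p.1 - p.2) * (v p.1 * f p.2)) := by
  refine (hv.mul_prod hf).bdd_mul (c := 1) ?_ ?_
  · exact (auxK_meas.comp (measurable_fst.sub measurable_snd)).aestronglyMeasurable
  · exact Filter.Eventually.of_forall fun x => by simpa using auxK_le' _

lemma aux_D (v f : ℝ → ℝ) (x : ℝ) :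
    v x * dConvOp f x = ∫ y, auxK (x - y) * (v x * f y) := by
  unfold dConvOp
  rw [← integral_const_mul]
  congr 1; ext y; unfold auxK; ring

lemma aux_S1 (v f : ℝ → ℝ) (hv : Integrable v) (hf : Integrable f) :
    Integrable (fun x => v x * dConvOp f x) := by
  simp only [aux_D]
  exact (aux_W v f hv hf).integral_prod_left

lemma aux_vr (v r : ℝ → ℝ) (hv : Integrable v) (hr : Integrable r)
    (hv2 : Integrable (fun x => v x ^ 2)) (s : ℝ) (hs : 0 < s)
    (hY : ∫ x, v x ^ 2 ≤ s ^ 2) :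
    ∫ p : ℝ × ℝ, |auxK (p.1 - p.2) * (v p.1 * r p.2)| ≤ (∫ y, |r y|) * s := by
  have h := (aux_W v r hv hr).abs
  rw [Measure.volume_eq_prod] at h ⊢
  rw [integral_prod_symm _ h, ← integral_mul_const]
  refine integral_mono h.integral_prod_right (hr.abs.mul_const s) ?_
  intro y
  simp only []
  have : ∀ x, |auxK (x - y) * (v x * r y)| = |r y| * (|auxK (x - y)| * |v x|) := by
    intro x; rw [abs_mul, abs_mul]; ring
  simp only [this]
  rw [integral_const_mul]
  exact mul_le_mul_of_nonneg_left (aux_cs v hv2 s hs hY y) (abs_nonneg _)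

lemma aux_vv (v : ℝ → ℝ) (hv : Integrable v) 
    (hv2 : Integrable (fun x => v x ^ 2)) :
    ∫ p : ℝ × ℝ, |auxK (p.1 - p.2) * (v p.1 * v p.2)| ≤ (∫ z, |auxK z|) * ∫ x, v x ^ 2 := by
  have h := (aux_W v v hv hv).abs
  have h1 : Integrable (fun p : ℝ × ℝ => v p.2 ^ 2 * |auxK (p.1 - p.2)|) := by
    have := hv2.convolution_integrand (ContinuousLinearMap.mul ℝ ℝ) (auxK_int.abs)
    rw [Measure.volume_eq_prod]
    simpa using this
  have h2 : Integrable (fun p : ℝ × ℝ => v p.1 ^ 2 * |auxK (p.1 - p.2)|) := by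
    have := h1.swap
    refine this.congr (Filter.Eventually.of_forall fun p => ?_)
    simp only [Function.comp, Prod.swap]
    rw [← neg_sub p.1 p.2, auxK_odd, abs_neg]
  have i1 : ∫ p : ℝ × ℝ, v p.2 ^ 2 * |auxK (p.1 - p.2)| = (∫ z, |auxK z|) * ∫ x, v x ^ 2 := by
    rw [Measure.volume_eq_prod] at h1 ⊢
    rw [integral_prod_symm _ h1]
    simp only []
    have : ∀ y, ∫ x, v y ^ 2 * |auxK (x - y)| = (∫ z, |auxK z|) * v y ^ 2 := by
      intro y
      rw [integral_const_mul, integral_sub_right_eq_self (fun z => |auxK z|) y]; ring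
    simp only [this]
    rw [integral_const_mul]
  have i2 : ∫ p : ℝ × ℝ, v p.1 ^ 2 * |auxK (p.1 - p.2)| = (∫ z, |auxK z|) * ∫ x, v x ^ 2 := by
    rw [Measure.volume_eq_prod] at h2 ⊢
    rw [integral_prod _ h2]
    simp only []
    have : ∀ x, ∫ y, v x ^ 2 * |auxK (x - y)| = (∫ z, |auxK z|) * v x ^ 2 := by
      intro x
      rw [integral_const_mul, integral_sub_left_eq_self (fun z => |auxK z|) volume x]; ring
    simp only [this]
    rw [integral_const_mul]
  have h3 : ∫ p : ℝ × ℝ, |auxK (p.1 - p.2) * (v p.1 * v p.2)| ≤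
      ∫ p : ℝ × ℝ, (1/2) * (v p.1 ^ 2 * |auxK (p.1 - p.2)| + v p.2 ^ 2 * |auxK (p.1 - p.2)|) := by
    refine integral_mono h ((h2.add h1).const_mul _) ?_
    intro p
    simp only []
    rw [abs_mul, abs_mul]
    have := mul_nonneg (abs_nonneg (auxK (p.1 - p.2))) (sq_nonneg (|v p.1| - |v p.2|))
    have e1 := sq_abs (v p.1)
    have e2 := sq_abs (v p.2)
    rw [← e1, ← e2]
    nlinarith
  rw [integral_const_mul, integral_add h2 h1, i1, i2] at h3
  linarith

lemma aux_S2 (v r : ℝ → ℝ) (hv : Integrable v) (hr : Integrable r)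
    (hv2 : Integrable (fun x => v x ^ 2)) (s : ℝ) (hs : 0 < s)
    (hY : ∫ x, v x ^ 2 ≤ s ^ 2) :
    ∫ x, |v x * dConvOp (fun y => r y - v y) x| ≤
      (∫ y, |r y|) * s + (∫ z, |auxK z|) * s ^ 2 := by
  have hW := aux_W v (fun y => r y - v y) hv (hr.sub hv)
  have h1 := (aux_W v r hv hr).abs
  have h2 := (aux_W v v hv hv).abs
  have hk : 0 ≤ ∫ z, |auxK z| := integral_nonneg fun _ => abs_nonneg _
  calc ∫ x, |v x * dConvOp (fun y => r y - v y) x|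
      ≤ ∫ x, ∫ y, |auxK (x - y) * (v x * (r y - v y))| := by
        refine integral_mono (aux_S1 v _ hv (hr.sub hv)).abs hW.abs.integral_prod_left ?_
        intro x
        simp only [aux_D]
        exact abs_integral_le_integral_abs
    _ = ∫ p : ℝ × ℝ, |auxK (p.1 - p.2) * (v p.1 * (r p.2 - v p.2))| := by
        rw [Measure.volume_eq_prod] at hW ⊢
        rw [integral_prod _ hW.abs]
    _ ≤ ∫ p : ℝ × ℝ, (|auxK (p.1 - p.2) * (v p.1 * r p.2)| + |auxK (p.1 - p.2) * (v p.1 * v p.2)|) := by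
        refine integral_mono hW.abs (h1.add h2) ?_
        intro p
        simp only [mul_sub]
        exact abs_sub _ _
    _ ≤ _ := by
        rw [integral_add h1 h2]
        refine add_le_add (aux_vr v r hv hr hv2 s hs hY) ((aux_vv v hv hv2).trans ?_)
        gcongr

lemma aux_S3 (v r : ℝ → ℝ) (hv : Integrable v) (hr : Integrable r)
    (hv2 : Integrable (fun x => v x ^ 2)) (s : ℝ) (hs : 0 < s)
    (hY : ∫ x, v x ^ 2 ≤ s ^ 2) :
    |∫ x, v x * dConvOp (fun y => r y - v y) x| ≤ (∫ y, |r y|) * s := by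
  have hW := aux_W v (fun y => r y - v y) hv (hr.sub hv)
  have h1 := aux_W v r hv hr
  have h2 := aux_W v v hv hv
  have e0 : ∫ p : ℝ × ℝ, auxK (p.1 - p.2) * (v p.1 * v p.2) = 0 := by
    have := integral_prod_swap (μ := (volume : Measure ℝ)) (ν := (volume : Measure ℝ))
      (fun p : ℝ × ℝ => auxK (p.1 - p.2) * (v p.1 * v p.2))
    rw [← Measure.volume_eq_prod] at this
    have h3 : ∀ p : ℝ × ℝ, auxK (p.swap.1 - p.swap.2) * (v p.swap.1 * v p.swap.2) =
        - (auxK (p.1 - p.2) * (v p.1 * v p.2)) := by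
      intro p
      simp only [Prod.swap]
      rw [← neg_sub p.1 p.2, auxK_odd]; ring
    simp only [h3, integral_neg] at this
    linarith
  have e1 : ∫ x, v x * dConvOp (fun y => r y - v y) x =
      ∫ p : ℝ × ℝ, auxK (p.1 - p.2) * (v p.1 * r p.2) := by
    simp only [aux_D]
    have : ∫ p : ℝ × ℝ, auxK (p.1 - p.2) * (v p.1 * (r p.2 - v p.2)) =
        ∫ p : ℝ × ℝ, auxK (p.1 - p.2) * (v p.1 * r p.2) := by
      simp only [mul_sub]
      rw [integral_sub h1 h2, e0, sub_zero]
    rw [← this]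
    rw [Measure.volume_eq_prod] at hW ⊢
    rw [integral_prod _ hW]
  rw [e1]
  exact abs_integral_le_integral_abs.trans (aux_vr v r hv hr hv2 s hs hY)

noncomputable def auxPsi (κ s : ℝ) : ℝ := 2 * s / (1 + s ^ 2 / κ ^ 2)
noncomputable def auxEta (κ s : ℝ) : ℝ := κ ^ 2 * Real.log (1 + s ^ 2 / κ ^ 2)
noncomputable def auxQ (κ s : ℝ) : ℝ := ∫ r in (0:ℝ)..s, r * auxPsi κ r

lemma auxDen (κ s : ℝ) : 1 ≤ 1 + s ^ 2 / κ ^ 2 := by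
  have : 0 ≤ s ^ 2 / κ ^ 2 := by positivity
  linarith

lemma auxPsi_cont (κ : ℝ) : Continuous (auxPsi κ) := by
  unfold auxPsi
  refine Continuous.div (by fun_prop) (by fun_prop) (fun s => ?_)
  have := auxDen κ s
  positivity

lemma auxEta_cont (κ : ℝ) : Continuous (auxEta κ) := by
  unfold auxEta
  refine continuous_const.mul (Continuous.log (by fun_prop) (fun s => ?_))
  have := auxDen κ s
  positivity

lemma auxEta_deriv (κ s : ℝ) (hκ : 0 < κ) : HasDerivAt (auxEta κ) (auxPsi κ s) s := by
  have hd := auxDen κ s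
  have h1 : HasDerivAt (fun s : ℝ => 1 + s ^ 2 / κ ^ 2) (2 * s / κ ^ 2) s := by
    have := (((hasDerivAt_id s).fun_pow 2).div_const (κ ^ 2)).const_add 1
    simpa using this
  have h2 := (h1.log (by positivity)).const_mul (κ ^ 2)
  have h3 : κ ^ 2 * (2 * s / κ ^ 2 / (1 + s ^ 2 / κ ^ 2)) = auxPsi κ s := by
    unfold auxPsi
    have : 1 + s ^ 2 / κ ^ 2 ≠ 0 := by positivity
    rw [← mul_div_assoc, mul_div_cancel₀ _ (by positivity)]
  rw [h3] at h2
  exact h2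

lemma auxPsi_le (κ s : ℝ) : |auxPsi κ s| ≤ 2 * |s| := by
  have hd := auxDen κ s
  unfold auxPsi
  rw [abs_div, abs_of_pos (by linarith : 0 < 1 + s ^ 2 / κ ^ 2), abs_mul, abs_two]
  exact div_le_self (by positivity) hd

lemma auxEta_le (κ s : ℝ) (hκ : 0 < κ) : |auxEta κ s| ≤ s ^ 2 := by
  have hd := auxDen κ s
  unfold auxEta
  have h1 := Real.log_nonneg hd
  rw [abs_of_nonneg (by positivity)]
  have h2 := Real.log_le_sub_one_of_pos (by linarith : 0 < 1 + s ^ 2 / κ ^ 2)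
  calc κ ^ 2 * Real.log (1 + s ^ 2 / κ ^ 2) ≤ κ ^ 2 * (s ^ 2 / κ ^ 2) := by
        gcongr; linarith
    _ = s ^ 2 := by field_simp

lemma auxQ_deriv (κ s : ℝ) : HasDerivAt (auxQ κ) (s * auxPsi κ s) s := by
  have hc : Continuous (fun r => r * auxPsi κ r) := continuous_id.mul (auxPsi_cont κ)
  exact hc.integral_hasStrictDerivAt 0 s |>.hasDerivAt

lemma auxQ_le (κ s : ℝ) (hκ : 0 < κ) : |auxQ κ s| ≤ κ * s ^ 2 := by
  have h : ∀ r ∈ Set.uIoc 0 s, ‖r * auxPsi κ r‖ ≤ κ * |s| := by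
    intro r hr
    have hrs : |r| ≤ |s| := by
      rcases Set.mem_uIoc.1 hr with h | h
      · rw [abs_of_pos h.1, abs_of_pos (h.1.trans_le h.2)]; exact h.2
      · rw [abs_of_nonpos h.2, abs_of_neg (h.1.trans_le h.2)]; linarith
    refine le_trans ?_ (mul_le_mul_of_nonneg_left hrs hκ.le)
    have hd := auxDen κ r
    unfold auxPsi
    rw [Real.norm_eq_abs, abs_mul, abs_div, abs_of_pos (by linarith : 0 < 1 + r ^ 2 / κ ^ 2),
      abs_mul, abs_two, mul_comm κ]
    refine mul_le_mul_of_nonneg_left ?_ (abs_nonneg r)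
    rw [div_le_iff₀ (by linarith)]
    have h3 : κ * (1 + r ^ 2 / κ ^ 2) - 2 * |r| = (κ - |r|) ^ 2 / κ := by
      rw [← sq_abs r]; field_simp; ring
    have h4 : 0 ≤ (κ - |r|) ^ 2 / κ := by positivity
    linarith
  have := intervalIntegral.norm_integral_le_of_norm_le_const h
  unfold auxQ
  rw [Real.norm_eq_abs] at this
  refine this.trans (le_of_eq ?_)
  rw [sub_zero, ← sq_abs s]; ring

lemma auxQ_cont (κ : ℝ) : Continuous (auxQ κ) :=
  continuous_iff_continuousAt.2 fun s => (auxQ_deriv κ s).continuousAt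

open Filter Topology in
lemma auxk_tendsto : Tendsto (fun k : ℕ => ((k:ℝ) + 1) ^ 2) atTop atTop := by
  have h : Tendsto (fun k : ℕ => ((k:ℝ) + 1)) atTop atTop :=
    tendsto_atTop_add_const_right _ _ tendsto_natCast_atTop_atTop
  exact (tendsto_pow_atTop two_ne_zero).comp h

open Filter Topology in
lemma auxEta_tendsto (s : ℝ) : Tendsto (fun k : ℕ => auxEta ((k:ℝ) + 1) s) atTop (𝓝 (s ^ 2)) :=
  (Real.tendsto_mul_log_one_add_div_atTop (s ^ 2)).comp auxk_tendsto

open Filter Topology in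
lemma auxPsi_tendsto (s : ℝ) : Tendsto (fun k : ℕ => auxPsi ((k:ℝ) + 1) s) atTop (𝓝 (2 * s)) := by
  have h1 : Tendsto (fun k : ℕ => 1 + s ^ 2 / ((k:ℝ) + 1) ^ 2) atTop (𝓝 (1 + 0)) :=
    (auxk_tendsto.const_div_atTop (s ^ 2)).const_add 1
  have := (tendsto_const_nhds (x := 2 * s)).div h1 (by norm_num)
  rw [add_zero, div_one] at this
  exact this

open Filter Topology in
lemma aux_dct (h : ℕ → ℝ → ℝ) (h0 B : ℝ → ℝ) (hm : ∀ k, AEStronglyMeasurable (h k))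
    (hB : Integrable B) (hb : ∀ k x, |h k x| ≤ B x)
    (hl : ∀ x, Tendsto (fun k => h k x) atTop (𝓝 (h0 x))) :
    Tendsto (fun k : ℕ => ∫ x in (-((k:ℝ) + 1) ^ 2)..(((k:ℝ) + 1) ^ 2),
      (1 - x ^ 2 / (((k:ℝ) + 1) ^ 2) ^ 2) * h k x) atTop (𝓝 (∫ x, h0 x)) := by
  have hle : ∀ k : ℕ, (-((k:ℝ) + 1) ^ 2) ≤ (((k:ℝ) + 1) ^ 2) := by
    intro k
    have : 0 ≤ ((k:ℝ) + 1) ^ 2 := by positivity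
    linarith
  have he : ∀ k : ℕ, ∫ x in (-((k:ℝ) + 1) ^ 2)..(((k:ℝ) + 1) ^ 2),
      (1 - x ^ 2 / (((k:ℝ) + 1) ^ 2) ^ 2) * h k x =
      ∫ x, (Set.Ioc (-((k:ℝ) + 1) ^ 2) (((k:ℝ) + 1) ^ 2)).indicator
        (fun x => (1 - x ^ 2 / (((k:ℝ) + 1) ^ 2) ^ 2) * h k x) x := by
    intro k
    rw [intervalIntegral.integral_of_le (hle k), integral_indicator measurableSet_Ioc]
  simp only [he]
  refine tendsto_integral_filter_of_dominated_convergence B ?_ ?_ hB ?_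
  · refine Eventually.of_forall fun k => ?_
    refine AEStronglyMeasurable.indicator ?_ measurableSet_Ioc
    exact (Continuous.aestronglyMeasurable (by fun_prop)).mul (hm k)
  · refine Eventually.of_forall fun k => Eventually.of_forall fun x => ?_
    have hB0 : 0 ≤ B x := (abs_nonneg _).trans (hb k x)
    by_cases hx : x ∈ Set.Ioc (-((k:ℝ) + 1) ^ 2) (((k:ℝ) + 1) ^ 2)
    · rw [Set.indicator_of_mem hx, Real.norm_eq_abs, abs_mul]
      have h1 : x ^ 2 ≤ (((k:ℝ) + 1) ^ 2) ^ 2 := by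
        apply sq_le_sq'
        · linarith [hx.1]
        · exact hx.2
      have h2 : x ^ 2 / (((k:ℝ) + 1) ^ 2) ^ 2 ≤ 1 := div_le_one_of_le₀ h1 (by positivity)
      have h3 : 0 ≤ x ^ 2 / (((k:ℝ) + 1) ^ 2) ^ 2 := by positivity
      rw [abs_of_nonneg (by linarith)]
      calc _ ≤ 1 * |h k x| := mul_le_mul_of_nonneg_right (by linarith) (abs_nonneg _)
        _ ≤ B x := by rw [one_mul]; exact hb k x
    · rw [Set.indicator_of_notMem hx]; simpa using hB0
  · refine Eventually.of_forall fun x => ?_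
    have h1 : Tendsto (fun k : ℕ => (((k:ℝ) + 1) ^ 2) ^ 2) atTop atTop :=
      (tendsto_pow_atTop two_ne_zero).comp auxk_tendsto
    have h2 : Tendsto (fun k : ℕ => (1 - x ^ 2 / (((k:ℝ) + 1) ^ 2) ^ 2) * h k x) atTop
        (𝓝 ((1 - 0) * h0 x)) :=
      ((h1.const_div_atTop (x ^ 2)).const_sub 1).mul (hl x)
    rw [sub_zero, one_mul] at h2
    refine h2.congr' ?_
    filter_upwards [auxk_tendsto.eventually_gt_atTop |x|] with k hk
    have := abs_lt.1 hk
    rw [Set.indicator_of_mem]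
    exact ⟨by linarith [this.1], this.2.le⟩

lemma aux_bd (R c : ℝ) (hR : 0 ≤ R) (hc : 0 ≤ c) (w h B : ℝ → ℝ) (hw : ∀ x, |x| ≤ R → |w x| ≤ c)
    (hB : Integrable B) (hb : ∀ x, |h x| ≤ B x) :
    |∫ x in (-R)..R, w x * h x| ≤ c * ∫ x, B x := by
  have hle : -R ≤ R := by linarith
  have h1 := intervalIntegral.norm_integral_le_of_norm_le (μ := volume) (a := -R) (b := R)
    (f := fun x => w x * h x) (g := fun x => c * B x) hle
    (Filter.Eventually.of_forall fun x hx => by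
      rw [Real.norm_eq_abs, abs_mul]
      exact mul_le_mul (hw x (abs_le.2 ⟨hx.1.le, hx.2⟩)) (hb x) (abs_nonneg _) hc)
    (hB.const_mul c).intervalIntegrable
  rw [Real.norm_eq_abs] at h1
  refine h1.trans ?_
  rw [intervalIntegral.integral_const_mul, intervalIntegral.integral_of_le hle]
  refine mul_le_mul_of_nonneg_left ?_ hc
  exact setIntegral_le_integral hB (Filter.Eventually.of_forall fun x => (abs_nonneg _).trans (hb x))

lemma aux_ftc (u Dt : ℝ → ℝ → ℝ) (hu : Continuous (Function.uncurry u))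
    (hDt : Continuous (Function.uncurry Dt))
    (hd : ∀ t x, HasDerivAt (fun s => u s x) (Dt t x) t)
    (κ R a b : ℝ) (hκ : 0 < κ) :
    (∫ x in (-R)..R, (1 - x ^ 2 / R ^ 2) * auxEta κ (u b x)) -
      (∫ x in (-R)..R, (1 - x ^ 2 / R ^ 2) * auxEta κ (u a x)) =
    ∫ τ in a..b, ∫ x in (-R)..R, (1 - x ^ 2 / R ^ 2) * (auxPsi κ (u τ x) * Dt τ x) := by
  have hux : ∀ t, Continuous (u t) := fun t => hu.comp (by fun_prop : Continuous fun x => (t, x))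
  have hc : ∀ t, Continuous (fun x => (1 - x ^ 2 / R ^ 2) * auxEta κ (u t x)) := fun t =>
    (by fun_prop : Continuous fun x : ℝ => 1 - x ^ 2 / R ^ 2).mul ((auxEta_cont κ).comp (hux t))
  have hF : Continuous (Function.uncurry fun τ x =>
      (1 - x ^ 2 / R ^ 2) * (auxPsi κ (u τ x) * Dt τ x)) := by
    have h1 : Continuous (fun p : ℝ × ℝ => (1 - p.2 ^ 2 / R ^ 2)) := by fun_prop
    exact h1.mul (((auxPsi_cont κ).comp hu).mul hDt)
  rw [← intervalIntegral.integral_sub ((hc b).intervalIntegrable _ _)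
    ((hc a).intervalIntegrable _ _)]
  rw [intervalIntegral_intervalIntegral_swap]
  · refine intervalIntegral.integral_congr fun x _ => ?_
    rw [intervalIntegral.integral_const_mul, intervalIntegral.integral_eq_sub_of_hasDerivAt
      (f := fun τ => auxEta κ (u τ x))]
    · ring
    · intro τ _
      exact HasDerivAt.comp (h₂ := auxEta κ) τ (auxEta_deriv κ (u τ x) hκ) (hd τ x)
    · have hDx : Continuous (fun τ => Dt τ x) := hDt.comp (by fun_prop : Continuous fun τ => (τ, x))
      have hux : Continuous (fun τ => u τ x) := hu.comp (by fun_prop : Continuous fun τ => (τ, x))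
      exact (((auxPsi_cont κ).comp hux).mul hDx).intervalIntegrable _ _
  · exact (hF.continuousOn.integrableOn_compact (isCompact_uIcc.prod isCompact_uIcc)).mono_set
      (Set.prod_mono Set.uIoc_subset_uIcc Set.uIoc_subset_uIcc)

lemma aux_parts (v Dv : ℝ → ℝ) (hv : Continuous v) (hDv : Continuous Dv)
    (hd : ∀ x, HasDerivAt v (Dv x) x) (κ R : ℝ) (hR : 0 < R) :
    ∫ x in (-R)..R, (1 - x ^ 2 / R ^ 2) * (auxPsi κ (v x) * (v x * Dv x)) =
      - ∫ x in (-R)..R, (-(2 * x / R ^ 2)) * auxQ κ (v x) := by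
  have h := intervalIntegral.integral_mul_deriv_eq_deriv_mul (a := -R) (b := R)
    (u := fun x => 1 - x ^ 2 / R ^ 2) (u' := fun x => -(2 * x / R ^ 2))
    (v := fun x => auxQ κ (v x)) (v' := fun x => v x * auxPsi κ (v x) * Dv x)
    (fun x _ => by
      have := (((hasDerivAt_id x).fun_pow 2).div_const (R ^ 2)).const_sub 1
      simpa using this)
    (fun x _ => (auxQ_deriv κ (v x)).comp x (hd x))
    (Continuous.intervalIntegrable (by fun_prop) _ _)
    (((hv.mul ((auxPsi_cont κ).comp hv)).mul hDv).intervalIntegrable _ _)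
  have e : ∀ x, (1 - x ^ 2 / R ^ 2) * (auxPsi κ (v x) * (v x * Dv x)) =
    (1 - x ^ 2 / R ^ 2) * (v x * auxPsi κ (v x) * Dv x) := fun x => by ring
  simp only [e]
  rw [h]
  have h1 : 1 - R ^ 2 / R ^ 2 = 0 := by rw [div_self (by positivity)]; ring
  simp only [neg_sq, h1]
  ring

open Filter Topology in
lemma aux_energy (u Dt Dx ρ : ℝ → ℝ → ℝ) (hu : Continuous (Function.uncurry u))
    (hDt : Continuous (Function.uncurry Dt)) (hDx : Continuous (Function.uncurry Dx))
    (hdt : ∀ t x, HasDerivAt (fun s => u s x) (Dt t x) t)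
    (hdx : ∀ t x, HasDerivAt (u t) (Dx t x) x)
    (a b M C : ℝ) (hab : a ≤ b) (hC : 0 < C)
    (hint : ∀ t ∈ Set.Icc a b,
      Integrable (u t) ∧ Integrable (fun x => (u t x) ^ 2) ∧ Integrable (ρ t))
    (hM : ∀ t ∈ Set.Icc a b, ∫ x, |ρ t x| = M)
    (hY : ∀ t ∈ Set.Icc a b, ∫ x, (u t x) ^ 2 ≤ C ^ 2)
    (hpde : ∀ t ∈ Set.Icc a b, ∀ x,
      Dt t x + u t x * Dx t x = dConvOp (fun y => ρ t y - u t y) x) :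
    |(∫ x, (u b x) ^ 2) - ∫ x, (u a x) ^ 2| ≤ 2 * M * C * (b - a) := by
  have hux : ∀ t, Continuous (u t) := fun t => hu.comp (by fun_prop : Continuous fun x => (t, x))
  have hDtx : ∀ t, Continuous (Dt t) := fun t => hDt.comp (by fun_prop : Continuous fun x => (t, x))
  have hDxx : ∀ t, Continuous (Dx t) := fun t => hDx.comp (by fun_prop : Continuous fun x => (t, x))
  set g : ℕ → ℝ → ℝ := fun k τ => ∫ x in (-((k:ℝ) + 1) ^ 2)..(((k:ℝ) + 1) ^ 2),
      (1 - x ^ 2 / (((k:ℝ) + 1) ^ 2) ^ 2) * (auxPsi ((k:ℝ) + 1) (u τ x) * Dt τ x) with hg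
  set F : ℝ → ℝ → ℝ := fun t x => Dt t x + u t x * Dx t x with hF
  set h : ℝ → ℝ := fun τ => ∫ x, 2 * (u τ x * F τ x) with hh
  set A : ℝ := M * C + (∫ z, |auxK z|) * C ^ 2 with hA
  have hFx : ∀ t, Continuous (F t) := fun t => (hDtx t).add ((hux t).mul (hDxx t))
  have hFI : ∀ t ∈ Set.Icc a b, Integrable (fun x => u t x * F t x) := by
    intro t ht
    obtain ⟨h1, h2, h3⟩ := hint t ht
    have := aux_S1 (u t) (fun y => ρ t y - u t y) h1 (h3.sub h1)
    simpa only [hF, hpde t ht] using this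
  have hFA : ∀ t ∈ Set.Icc a b, ∫ x, |u t x * F t x| ≤ A := by
    intro t ht
    obtain ⟨h1, h2, h3⟩ := hint t ht
    have := aux_S2 (u t) (ρ t) h1 h3 h2 C hC (hY t ht)
    simpa only [hF, hpde t ht, hM t ht] using this
  have hhb : ∀ t ∈ Set.Icc a b, |h t| ≤ 2 * M * C := by
    intro t ht
    obtain ⟨h1, h2, h3⟩ := hint t ht
    have := aux_S3 (u t) (ρ t) h1 h3 h2 C hC (hY t ht)
    simp only [hh, hF, hpde t ht]
    rw [integral_const_mul, abs_mul, abs_two]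
    rw [hM t ht] at this
    linarith
  -- decomposition of g
  have hgdec : ∀ k τ, g k τ = (∫ x in (-((k:ℝ) + 1) ^ 2)..(((k:ℝ) + 1) ^ 2),
      (1 - x ^ 2 / (((k:ℝ) + 1) ^ 2) ^ 2) * (auxPsi ((k:ℝ) + 1) (u τ x) * F τ x)) +
      ∫ x in (-((k:ℝ) + 1) ^ 2)..(((k:ℝ) + 1) ^ 2),
        (-(2 * x / (((k:ℝ) + 1) ^ 2) ^ 2)) * auxQ ((k:ℝ) + 1) (u τ x) := by
    intro k τ
    have hp := aux_parts (u τ) (Dx τ) (hux τ) (hDxx τ) (hdx τ) ((k:ℝ) + 1) (((k:ℝ) + 1) ^ 2)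
      (by positivity)
    have hφ : Continuous (fun x : ℝ => 1 - x ^ 2 / (((k:ℝ) + 1) ^ 2) ^ 2) := by fun_prop
    have hψ := (auxPsi_cont ((k:ℝ) + 1)).comp (hux τ)
    have c1 : Continuous (fun x => (1 - x ^ 2 / (((k:ℝ) + 1) ^ 2) ^ 2) *
        (auxPsi ((k:ℝ) + 1) (u τ x) * F τ x)) := hφ.mul (hψ.mul (hFx τ))
    have c2 : Continuous (fun x => (1 - x ^ 2 / (((k:ℝ) + 1) ^ 2) ^ 2) *
        (auxPsi ((k:ℝ) + 1) (u τ x) * (u τ x * Dx τ x))) :=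
      hφ.mul (hψ.mul ((hux τ).mul (hDxx τ)))
    rw [← neg_eq_iff_eq_neg.2 hp, ← sub_eq_add_neg, ← intervalIntegral.integral_sub
      (c1.intervalIntegrable _ _) (c2.intervalIntegrable _ _)]
    simp only [hg]
    refine intervalIntegral.integral_congr fun x _ => ?_
    simp only [hF]
    ring
  have hψF : ∀ (k : ℕ) τ x, |auxPsi ((k:ℝ) + 1) (u τ x) * F τ x| ≤ 2 * |u τ x * F τ x| := by
    intro k τ x
    rw [abs_mul, abs_mul, ← mul_assoc]
    exact mul_le_mul_of_nonneg_right (auxPsi_le _ _) (abs_nonneg _)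
  have hQb : ∀ (k : ℕ), ∀ τ ∈ Set.Icc a b, |∫ x in (-((k:ℝ) + 1) ^ 2)..(((k:ℝ) + 1) ^ 2),
        (-(2 * x / (((k:ℝ) + 1) ^ 2) ^ 2)) * auxQ ((k:ℝ) + 1) (u τ x)| ≤ 2 * C ^ 2 / ((k:ℝ) + 1) := by
    intro k τ hτ
    obtain ⟨h1, h2, h3⟩ := hint τ hτ
    set κ : ℝ := (k:ℝ) + 1 with hκ
    have hκ0 : 0 < κ := by positivity
    have := aux_bd (κ ^ 2) (2 / κ ^ 2) (by positivity) (by positivity)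
      (fun x => (-(2 * x / (κ ^ 2) ^ 2))) (fun x => auxQ κ (u τ x)) (fun x => κ * u τ x ^ 2)
      (by
        intro x hx
        rw [abs_neg, abs_div, abs_mul, abs_two, abs_of_pos (by positivity : 0 < (κ ^ 2) ^ 2)]
        calc 2 * |x| / (κ ^ 2) ^ 2 ≤ 2 * κ ^ 2 / (κ ^ 2) ^ 2 := by gcongr
          _ = _ := by field_simp)
      (h2.const_mul κ) (fun x => auxQ_le κ _ hκ0)
    refine this.trans ?_
    rw [integral_const_mul]
    calc 2 / κ ^ 2 * (κ * ∫ x, u τ x ^ 2) ≤ 2 / κ ^ 2 * (κ * C ^ 2) := by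
          gcongr; exact hY τ hτ
      _ = _ := by field_simp
  have hgb : ∀ (k : ℕ), ∀ τ ∈ Set.Icc a b, |g k τ| ≤ 2 * A + 2 * C ^ 2 := by
    intro k τ hτ
    rw [hgdec]
    refine (abs_add_le _ _).trans (add_le_add ?_ ((hQb k τ hτ).trans ?_))
    · have hκ0 : 0 < (k:ℝ) + 1 := by positivity
      have := aux_bd (((k:ℝ) + 1) ^ 2) 1 (by positivity) (by positivity)
        (fun x => (1 - x ^ 2 / (((k:ℝ) + 1) ^ 2) ^ 2))
        (fun x => auxPsi ((k:ℝ) + 1) (u τ x) * F τ x) (fun x => 2 * |u τ x * F τ x|)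
        (by
          intro x hx
          have h1 : x ^ 2 ≤ (((k:ℝ) + 1) ^ 2) ^ 2 := by
            rw [← sq_abs x]; gcongr
          have h2 : x ^ 2 / (((k:ℝ) + 1) ^ 2) ^ 2 ≤ 1 := div_le_one_of_le₀ h1 (by positivity)
          have h3 : 0 ≤ x ^ 2 / (((k:ℝ) + 1) ^ 2) ^ 2 := by positivity
          rw [abs_le]; constructor <;> linarith)
        ((hFI τ hτ).abs.const_mul 2) (fun x => hψF k τ x)
      refine this.trans ?_
      rw [integral_const_mul, one_mul]
      linarith [hFA τ hτ]
    · refine div_le_self (by positivity) ?_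
      have : (0:ℝ) ≤ k := by positivity
      linarith
  have hgl : ∀ τ ∈ Set.Icc a b, Tendsto (fun k => g k τ) atTop (𝓝 (h τ)) := by
    intro τ hτ
    have h1 : Tendsto (fun k : ℕ => ∫ x in (-((k:ℝ) + 1) ^ 2)..(((k:ℝ) + 1) ^ 2),
        (-(2 * x / (((k:ℝ) + 1) ^ 2) ^ 2)) * auxQ ((k:ℝ) + 1) (u τ x)) atTop (𝓝 0) := by
      refine squeeze_zero_norm (fun k => hQb k τ hτ) ?_
      have : Tendsto (fun k : ℕ => ((k:ℝ) + 1)) atTop atTop :=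
        tendsto_atTop_add_const_right _ _ tendsto_natCast_atTop_atTop
      exact this.const_div_atTop _
    have h2 := aux_dct (fun k x => auxPsi ((k:ℝ) + 1) (u τ x) * F τ x)
      (fun x => 2 * (u τ x * F τ x)) (fun x => 2 * |u τ x * F τ x|)
      (fun k => (((auxPsi_cont _).comp (hux τ)).mul (hFx τ)).aestronglyMeasurable)
      ((hFI τ hτ).abs.const_mul 2) (fun k x => hψF k τ x)
      (fun x => by
        have := (auxPsi_tendsto (u τ x)).mul_const (F τ x)
        rw [mul_assoc] at this
        exact this)
    have h3 := h2.add h1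
    rw [add_zero] at h3
    refine h3.congr fun k => ?_
    rw [hgdec]
  have hgc : ∀ k, Continuous (g k) := by
    intro k
    refine intervalIntegral.continuous_parametric_intervalIntegral_of_continuous' ?_ _ _
    have h1 : Continuous (fun p : ℝ × ℝ => (1 - p.2 ^ 2 / (((k:ℝ) + 1) ^ 2) ^ 2)) := by fun_prop
    exact h1.mul (((auxPsi_cont _).comp hu).mul hDt)
  have huIoc : ∀ τ ∈ Set.uIoc a b, τ ∈ Set.Icc a b := by
    intro τ hτ
    rw [Set.uIoc_of_le hab] at hτ
    exact ⟨hτ.1.le, hτ.2⟩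
  have hlim1 : Tendsto (fun k => ∫ τ in a..b, g k τ) atTop (𝓝 (∫ τ in a..b, h τ)) := by
    refine intervalIntegral.tendsto_integral_filter_of_dominated_convergence
      (fun _ => 2 * A + 2 * C ^ 2) ?_ ?_ ?_ ?_
    · exact Eventually.of_forall fun k => (hgc k).aestronglyMeasurable
    · exact Eventually.of_forall fun k => Eventually.of_forall fun τ hτ => hgb k τ (huIoc τ hτ)
    · exact intervalIntegrable_const
    · exact Eventually.of_forall fun τ hτ => hgl τ (huIoc τ hτ)
  have hlim2 : ∀ t ∈ Set.Icc a b, Tendsto (fun k : ℕ =>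
      ∫ x in (-((k:ℝ) + 1) ^ 2)..(((k:ℝ) + 1) ^ 2),
      (1 - x ^ 2 / (((k:ℝ) + 1) ^ 2) ^ 2) * auxEta ((k:ℝ) + 1) (u t x)) atTop
      (𝓝 (∫ x, u t x ^ 2)) := by
    intro t ht
    exact aux_dct (fun k x => auxEta ((k:ℝ) + 1) (u t x)) (fun x => u t x ^ 2) (fun x => u t x ^ 2)
      (fun k => ((auxEta_cont _).comp (hux t)).aestronglyMeasurable) (hint t ht).2.1
      (fun k x => auxEta_le _ _ (by positivity)) (fun x => auxEta_tendsto _)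
  have hlim3 := (hlim2 b ⟨hab, le_rfl⟩).sub (hlim2 a ⟨le_rfl, hab⟩)
  have heq : (∫ x, (u b x) ^ 2) - ∫ x, (u a x) ^ 2 = ∫ τ in a..b, h τ := by
    refine tendsto_nhds_unique (hlim3.congr fun k => ?_) hlim1
    exact aux_ftc u Dt hu hDt hdt ((k:ℝ) + 1) (((k:ℝ) + 1) ^ 2) a b (by positivity)
  rw [heq]
  have := intervalIntegral.norm_integral_le_of_norm_le_const (a := a) (b := b) (f := h)
    (C := 2 * M * C) (fun τ hτ => hhb τ (huIoc τ hτ))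
  rwa [Real.norm_eq_abs, abs_of_nonneg (sub_nonneg.2 hab)] at this

open Filter Topology in
lemma aux_lsc (u : ℝ → ℝ → ℝ) (hu : Continuous (Function.uncurry u)) (L : ℝ)
    (hint : ∀ t ∈ Set.Icc 0 L, Integrable (fun x => (u t x) ^ 2)) (n : ℕ) :
    IsClosed {t | t ∈ Set.Icc 0 L ∧ Real.sqrt (∫ x, u t x ^ 2) ≤ n} := by
  have hux : ∀ t, Continuous (u t) := fun t => hu.comp (by fun_prop : Continuous fun x => (t, x))
  refine IsSeqClosed.isClosed ?_
  intro s t hs hst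
  have ht : t ∈ Set.Icc 0 L := isClosed_Icc.mem_of_tendsto hst (Eventually.of_forall fun k => (hs k).1)
  refine ⟨ht, ?_⟩
  have hle : ∀ k, ∫⁻ x, ENNReal.ofReal (u (s k) x ^ 2) ≤ ENNReal.ofReal ((n:ℝ) ^ 2) := by
    intro k
    rw [← ofReal_integral_eq_lintegral_ofReal (hint _ (hs k).1)
      (Eventually.of_forall fun x => sq_nonneg _)]
    exact ENNReal.ofReal_le_ofReal ((Real.sqrt_le_left (by positivity)).1 (hs k).2)
  have hF := lintegral_liminf_le (μ := (volume : Measure ℝ)) (u := (atTop : Filter ℕ))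
    (f := fun k x => ENNReal.ofReal (u (s k) x ^ 2))
    (fun k => (ENNReal.continuous_ofReal.comp ((hux (s k)).fun_pow 2)).measurable)
  have hpt : ∀ x, liminf (fun k => ENNReal.ofReal (u (s k) x ^ 2)) atTop =
      ENNReal.ofReal (u t x ^ 2) := by
    intro x
    refine Tendsto.liminf_eq ?_
    have hc : Continuous (fun t => ENNReal.ofReal (u t x ^ 2)) :=
      ENNReal.continuous_ofReal.comp
        ((hu.comp (by fun_prop : Continuous fun t => (t, x))).pow 2)
    exact (hc.tendsto t).comp hst
  simp only [hpt] at hF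
  have h2 : ∫⁻ x, ENNReal.ofReal (u t x ^ 2) ≤ ENNReal.ofReal ((n:ℝ) ^ 2) := by
    refine hF.trans ?_
    refine (liminf_le_liminf (Eventually.of_forall hle)).trans ?_
    simp
  rw [← ofReal_integral_eq_lintegral_ofReal (hint _ ht)
      (Eventually.of_forall fun x => sq_nonneg _), ENNReal.ofReal_le_ofReal_iff (by positivity)] at h2
  exact (Real.sqrt_le_left (by positivity)).2 h2

/-- For a smooth decaying solution of `uₜ + uuₓ = ∂ₓ(I-∂ₓ²)⁻¹(ρ̄ - u)` with `ρ̄ ≥ 0` and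
conserved `L¹` mass of `ρ̄`: `d/dt ‖u(t)‖_{L²} ≤ ‖ρ̄₀‖_{L¹}`, hence
`‖u(t)‖_{L²} ≤ ‖u₀‖_{L²} + ‖ρ̄₀‖_{L¹} t`. -/
theorem L2_growth_estimate (T : ℝ) (u ut ux ρ : ℝ → ℝ → ℝ)
    (hsmooth : ContDiff ℝ (⊤ : ℕ∞) (Function.uncurry u))
    (hut : ∀ t ∈ Set.Ico 0 T, ∀ x, HasDerivAt (fun s => u s x) (ut t x) t)
    (hux : ∀ t ∈ Set.Ico 0 T, ∀ x, HasDerivAt (u t) (ux t x) x)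
    (hint : ∀ t ∈ Set.Ico 0 T,
      Integrable (u t) ∧ Integrable (fun x => (u t x) ^ 2) ∧ Integrable (ρ t))
    (hρpos : ∀ t ∈ Set.Ico 0 T, ∀ x, 0 ≤ ρ t x)
    (hmass : ∀ t ∈ Set.Ico 0 T, ∫ x : ℝ, |ρ t x| = ∫ x : ℝ, |ρ 0 x|)
    (hpde : ∀ t ∈ Set.Ico 0 T, ∀ x,
      ut t x + u t x * ux t x = dConvOp (fun y => ρ t y - u t y) x) :
    (∀ d : ℝ → ℝ,
      (∀ t ∈ Set.Ico 0 T, HasDerivAt (fun s => (∫ x : ℝ, (u s x) ^ 2) ^ (1/2 : ℝ)) (d t) t) →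
      ∀ t ∈ Set.Ico 0 T, d t ≤ ∫ x : ℝ, |ρ 0 x|) ∧
    (∀ t ∈ Set.Ico 0 T, (∫ x : ℝ, (u t x) ^ 2) ^ (1/2 : ℝ)
        ≤ (∫ x : ℝ, (u 0 x) ^ 2) ^ (1/2 : ℝ) + (∫ x : ℝ, |ρ 0 x|) * t) := by
  have hcd : Differentiable ℝ (Function.uncurry u) := hsmooth.differentiable (by simp)
  have hu : Continuous (Function.uncurry u) := hcd.continuous
  have hfd : Continuous (fderiv ℝ (Function.uncurry u)) := hsmooth.continuous_fderiv (by simp)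
  set Dt : ℝ → ℝ → ℝ := fun t x => fderiv ℝ (Function.uncurry u) (t, x) (1, 0) with hDtdef
  set Dx : ℝ → ℝ → ℝ := fun t x => fderiv ℝ (Function.uncurry u) (t, x) (0, 1) with hDxdef
  have hDt : Continuous (Function.uncurry Dt) := by
    have : Continuous (fun p : ℝ × ℝ => fderiv ℝ (Function.uncurry u) p (1, 0)) :=
      hfd.clm_apply continuous_const
    exact this
  have hDx : Continuous (Function.uncurry Dx) := by
    have : Continuous (fun p : ℝ × ℝ => fderiv ℝ (Function.uncurry u) p (0, 1)) :=
      hfd.clm_apply continuous_const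
    exact this
  have hdt : ∀ t x, HasDerivAt (fun s => u s x) (Dt t x) t := by
    intro t x
    have h1 : HasDerivAt (fun s : ℝ => (s, x)) ((1 : ℝ), (0 : ℝ)) t :=
      (hasDerivAt_id t).prodMk (hasDerivAt_const t x)
    exact (hcd (t, x)).hasFDerivAt.comp_hasDerivAt t h1
  have hdx : ∀ t x, HasDerivAt (u t) (Dx t x) x := by
    intro t x
    have h1 : HasDerivAt (fun y : ℝ => (t, y)) ((0 : ℝ), (1 : ℝ)) x :=
      (hasDerivAt_const x t).prodMk (hasDerivAt_id x)
    exact (hcd (t, x)).hasFDerivAt.comp_hasDerivAt x h1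
  set M : ℝ := ∫ x : ℝ, |ρ 0 x| with hMdef
  have hM0 : 0 ≤ M := integral_nonneg fun _ => abs_nonneg _
  have hY0 : ∀ t, 0 ≤ ∫ x : ℝ, (u t x) ^ 2 := fun t => integral_nonneg fun _ => sq_nonneg _
  simp only [← Real.sqrt_eq_rpow]
  set E : ℝ → ℝ := fun t => Real.sqrt (∫ x : ℝ, (u t x) ^ 2) with hE
  have hE0 : ∀ t, 0 ≤ E t := fun t => Real.sqrt_nonneg _
  have hE2 : ∀ t, E t ^ 2 = ∫ x : ℝ, (u t x) ^ 2 := fun t => Real.sq_sqrt (hY0 t)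
  have hpde' : ∀ t ∈ Set.Ico 0 T, ∀ x,
      Dt t x + u t x * Dx t x = dConvOp (fun y => ρ t y - u t y) x := by
    intro t ht x
    rw [← hpde t ht x, (hdt t x).unique (hut t ht x), (hdx t x).unique (hux t ht x)]
  have H : ∀ s t, 0 ≤ s → s ≤ t → t < T → ∀ C, 0 < C → (∀ τ ∈ Set.Icc s t, E τ ≤ C) →
      |E t ^ 2 - E s ^ 2| ≤ 2 * M * C * (t - s) := by
    intro s t hs hst ht C hC hb
    have hsub : ∀ τ ∈ Set.Icc s t, τ ∈ Set.Ico 0 T := fun τ hτ =>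
      ⟨hs.trans hτ.1, hτ.2.trans_lt ht⟩
    rw [hE2, hE2]
    refine aux_energy u Dt Dx ρ hu hDt hDx hdt hdx s t M C hst hC (fun τ hτ => hint τ (hsub τ hτ))
      (fun τ hτ => hmass τ (hsub τ hτ)) (fun τ hτ => ?_) (fun τ hτ => hpde' τ (hsub τ hτ))
    rw [← hE2]
    exact pow_le_pow_left₀ (hE0 τ) (hb τ hτ) 2
  have P : ∀ a b, 0 ≤ a → a ≤ b → b < T → (∃ S, ∀ t ∈ Set.Icc a b, E t ≤ S) →
      |E b - E a| ≤ M * (b - a) := by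
    rintro a b ha hab hb ⟨S, hS⟩
    exact aux_ode E M (max S 1) a b hM0 hab (by positivity) hE0
      (fun t ht => (hS t ht).trans (le_max_left _ _))
      (fun s t hs hst ht => H s t (ha.trans hs) hst (ht.trans_lt hb))
  have main : ∀ a b, 0 ≤ a → a ≤ b → b < T → E b - E a ≤ M * (b - a) := by
    intro a b ha hab hb
    obtain ⟨S, hS⟩ := aux_baire E M b hM0
      (fun n => aux_lsc u hu b (fun t ht => (hint t ⟨ht.1, ht.2.trans_lt hb⟩).2.1) n)
      (fun a' b' ha' hab' hb' h => P a' b' ha' hab' (hb'.trans_lt hb) h)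
    exact (abs_le.1 (P a b ha hab hb ⟨S, fun t ht => hS t ⟨ha.trans ht.1, ht.2⟩⟩)).2
  constructor
  · intro d hd t ht
    have h1 := (hd t ht).hasDerivWithinAt (s := Set.Ioi t)
    rw [hasDerivWithinAt_iff_tendsto_slope' (by simp)] at h1
    refine le_of_tendsto h1 ?_
    filter_upwards [Ioo_mem_nhdsGT ht.2] with z hz
    rw [slope_def_field, div_le_iff₀ (sub_pos.2 hz.1)]
    exact main t z ht.1 hz.1.le hz.2
  · intro t ht
    have := main 0 t le_rfl ht.1 ht.2
    simp only [hE, sub_zero] at this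
    linarith
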